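/- arXiv:2512.16124 — 2 statements merged into one kernel-verified Lean document; each statement's English description precedes it below -/
import Mathlib

section
/- Let (Ω, 𝓕, ℙ) be a probability space and (Y_k)_{k≥0} a sequence of real random variables. Suppose there exist p > α > 0 with sup_{k≥0} 𝔼[|Y_k|^p] < ∞. Then max_{0≤k≤n} |Y_k| / n^{1/α} → 0 in probability as n → ∞, i.e. for every ε > 0, ℙ( max_{0≤k≤n} |Y_k| > ε n^{1/α} ) → 0. -/
open MeasureTheory ENNReal Filter

/-- **Negligibility of the maximum (Lemma 3.1, second claim).** If
`sup_k 𝔼|Y_k|^p < ∞` for some `p > α > 0`, then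
`max_{0≤k≤n} |Y_k| / n^{1/α} → 0` in probability. -/
theorem max_over_n_pow_tendsto_zero_in_probability
    {Ω : Type*} [MeasurableSpace Ω] (μ : Measure Ω) [IsProbabilityMeasure μ]
    (Y : ℕ → Ω → ℝ) (hYmeas : ∀ k, Measurable (Y k))
    (p α : ℝ) (hα : 0 < α) (hpα : α < p)
    (hmom : ∃ C : ℝ, ∀ k : ℕ, ∫⁻ ω, ENNReal.ofReal (|Y k ω| ^ p) ∂μ ≤ ENNReal.ofReal C) :
    ∀ ε : ℝ, 0 < ε →
      Tendsto
        (fun n : ℕ =>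
          μ {ω | ε * (n : ℝ) ^ ((1 : ℝ) / α) <
            (Finset.range (n + 1)).sup' (by simp) (fun k => |Y k ω|)})
        atTop (nhds 0) := by
  intro ε hε
  obtain ⟨C, hC⟩ := hmom
  have hp : 0 < p := hα.trans hpα
  have hq : 0 < p / α - 1 := by
    rw [sub_pos, lt_div_iff₀ hα]; linarith
  have hεp : 0 < ε ^ p := Real.rpow_pos_of_pos hε p
  have hlim : Tendsto (fun n : ℕ =>
      ENNReal.ofReal ((2 * |C| / ε ^ p) * (n : ℝ) ^ (-(p / α - 1)))) atTop (nhds 0) := by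
    have h1 := ((tendsto_rpow_neg_atTop hq).comp
      (tendsto_natCast_atTop_atTop (R := ℝ))).const_mul (2 * |C| / ε ^ p)
    have h2 := ENNReal.tendsto_ofReal h1
    simpa using h2
  refine tendsto_of_tendsto_of_tendsto_of_le_of_le' tendsto_const_nhds hlim
    (Eventually.of_forall fun n => zero_le) ?_
  filter_upwards [eventually_ge_atTop 1] with n hn
  have hn1 : (1 : ℝ) ≤ n := by exact_mod_cast hn
  have hn0 : (0 : ℝ) < n := by linarith
  have ht : 0 < ε * (n : ℝ) ^ ((1 : ℝ) / α) := mul_pos hε (Real.rpow_pos_of_pos hn0 _)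
  set t := ε * (n : ℝ) ^ ((1 : ℝ) / α) with ht_def
  have htp : 0 < t ^ p := Real.rpow_pos_of_pos ht p
  have htp_eq : t ^ p = ε ^ p * (n : ℝ) ^ (p / α) := by
    rw [ht_def, Real.mul_rpow hε.le (Real.rpow_nonneg hn0.le _), ← Real.rpow_mul hn0.le]
    congr 2
    ring
  have hone : ∀ k, μ {ω | t < |Y k ω|} ≤ ENNReal.ofReal (|C| / t ^ p) := by
    intro k
    have hm : AEMeasurable (fun ω => ENNReal.ofReal (|Y k ω| ^ p)) μ := by
      have := hYmeas k
      have h3 : Measurable (fun ω => |Y k ω|) := this.abs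
      exact (h3.pow_const p).ennreal_ofReal.aemeasurable
    calc μ {ω | t < |Y k ω|}
        ≤ μ {ω | ENNReal.ofReal (t ^ p) ≤ ENNReal.ofReal (|Y k ω| ^ p)} := by
          apply measure_mono
          intro ω hω
          exact ENNReal.ofReal_le_ofReal (Real.rpow_le_rpow ht.le (le_of_lt hω) hp.le)
      _ ≤ (∫⁻ ω, ENNReal.ofReal (|Y k ω| ^ p) ∂μ) / ENNReal.ofReal (t ^ p) :=
          meas_ge_le_lintegral_div hm (by simpa using htp) ENNReal.ofReal_ne_top
      _ ≤ ENNReal.ofReal |C| / ENNReal.ofReal (t ^ p) :=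
          ENNReal.div_le_div_right
            ((hC k).trans (ENNReal.ofReal_le_ofReal (le_abs_self C))) _
      _ = ENNReal.ofReal (|C| / t ^ p) := (ENNReal.ofReal_div_of_pos htp).symm
  calc _ ≤ μ (⋃ k ∈ Finset.range (n + 1), {ω | t < |Y k ω|}) := by
        apply measure_mono
        intro ω hω
        simp only [Set.mem_setOf_eq, Finset.lt_sup'_iff] at hω
        obtain ⟨k, hk, h⟩ := hω
        exact Set.mem_biUnion (Finset.mem_coe.2 hk) h
    _ ≤ ∑ k ∈ Finset.range (n + 1), μ {ω | t < |Y k ω|} := measure_biUnion_finset_le _ _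
    _ ≤ ∑ k ∈ Finset.range (n + 1), ENNReal.ofReal (|C| / t ^ p) :=
        Finset.sum_le_sum fun k _ => hone k
    _ = ENNReal.ofReal (((n : ℝ) + 1) * (|C| / t ^ p)) := by
        rw [← ENNReal.ofReal_sum_of_nonneg (fun _ _ => by positivity)]
        simp
    _ ≤ _ := by
        apply ENNReal.ofReal_le_ofReal
        have hnn : (n : ℝ) ^ (-(p / α - 1)) = n / (n : ℝ) ^ (p / α) := by
          rw [neg_sub, Real.rpow_sub hn0, Real.rpow_one]
        have hpos : 0 < (n : ℝ) ^ (p / α) := Real.rpow_pos_of_pos hn0 _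
        rw [hnn]
        calc ((n : ℝ) + 1) * (|C| / t ^ p) ≤ (2 * n) * (|C| / t ^ p) := by
              gcongr
              linarith
          _ = _ := by
              rw [htp_eq]
              field_simp
end

section
/- Let (Ω, 𝓕, ℙ) be a probability space, n ≥ 1, y ∈ ℝ, and let M_1, …, M_n and r_0, …, r_n be real random variables. Define S_k = M_k + r_0 − r_k for 1 ≤ k ≤ n and K = max_{0≤j≤n} |r_j|. Then | ℙ( y + S_k > 0 for all 1 ≤ k ≤ n ) − ℙ( min_{1≤k≤n} (y + M_k) > 0 ) | ≤ ℙ( −2K < min_{1≤k≤n} (y + M_k) ≤ 2K ). -/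
open MeasureTheory

/-- **Martingale approximation of the survival probability (Lemma 4.2).** With
`S_k = M_k + r_0 - r_k` and `K = max_{0≤j≤n} |r_j|`, the difference between the
survival probability of the walk and that of its martingale part is bounded by
the small-strip probability `ℙ(-2K < min_{1≤k≤n}(y+M_k) ≤ 2K)`. -/
theorem survival_probability_martingale_comparison
    {Ω : Type*} [MeasurableSpace Ω] (μ : Measure Ω) [IsProbabilityMeasure μ]
    (n : ℕ) (hn : 1 ≤ n) (y : ℝ)
    (M : ℕ → Ω → ℝ) (hM : ∀ k, Measurable (M k))
    (r : ℕ → Ω → ℝ) (hr : ∀ j, Measurable (r j))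
    (S : ℕ → Ω → ℝ) (hS : ∀ k, 1 ≤ k → k ≤ n → ∀ ω, S k ω = M k ω + r 0 ω - r k ω)
    (K : Ω → ℝ) (hK : ∀ ω, K ω = (Finset.range (n + 1)).sup' (by simp) (fun j => |r j ω|))
    (minM : Ω → ℝ)
    (hmin : ∀ ω, minM ω = (Finset.Icc 1 n).inf' (by simp [hn]) (fun k => y + M k ω)) :
    |(μ {ω | ∀ k, 1 ≤ k → k ≤ n → 0 < y + S k ω}).toReal -
        (μ {ω | 0 < minM ω}).toReal| ≤
      (μ {ω | -(2 * K ω) < minM ω ∧ minM ω ≤ 2 * K ω}).toReal := by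
  have hle : ∀ ω j, j ≤ n → |r j ω| ≤ K ω := by
    intro ω j hj
    rw [hK ω]
    exact Finset.le_sup' (fun j => |r j ω|) (Finset.mem_range.mpr (by omega))
  have hml : ∀ ω k, 1 ≤ k → k ≤ n → minM ω ≤ y + M k ω := by
    intro ω k h1 h2
    rw [hmin ω]
    exact Finset.inf'_le (fun k => y + M k ω) (Finset.mem_Icc.mpr ⟨h1, h2⟩)
  have hatt : ∀ ω, ∃ k, 1 ≤ k ∧ k ≤ n ∧ minM ω = y + M k ω := by
    intro ω
    obtain ⟨k, hk, he⟩ := Finset.exists_mem_eq_inf' (s := Finset.Icc 1 n) (by simp [hn])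
      (fun k => y + M k ω)
    rw [Finset.mem_Icc] at hk
    exact ⟨k, hk.1, hk.2, (hmin ω).trans he⟩
  have key : ∀ A B C : Set Ω, A ⊆ B ∪ C → (μ A).toReal ≤ (μ B).toReal + (μ C).toReal := by
    intro A B C h
    exact (measureReal_mono (μ := μ) h).trans (measureReal_union_le B C)
  have h1 := key {ω | ∀ k, 1 ≤ k → k ≤ n → 0 < y + S k ω} {ω | 0 < minM ω}
    {ω | -(2 * K ω) < minM ω ∧ minM ω ≤ 2 * K ω} (by
      intro ω hω
      by_cases hp : 0 < minM ω
      · exact Or.inl hp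
      · right
        obtain ⟨k, hk1, hk2, he⟩ := hatt ω
        have a := hω k hk1 hk2
        rw [hS k hk1 hk2] at a
        have b := abs_le.mp (hle ω 0 (by omega))
        have c := abs_le.mp (hle ω k hk2)
        constructor <;> linarith [b.1, b.2, c.1, c.2])
  have h2 := key {ω | 0 < minM ω} {ω | ∀ k, 1 ≤ k → k ≤ n → 0 < y + S k ω}
    {ω | -(2 * K ω) < minM ω ∧ minM ω ≤ 2 * K ω} (by
      intro ω hω
      by_cases hp : ∀ k, 1 ≤ k → k ≤ n → 0 < y + S k ω
      · exact Or.inl hp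
      · right
        push Not at hp
        obtain ⟨k, hk1, hk2, a⟩ := hp
        rw [hS k hk1 hk2] at a
        have hω' : 0 < minM ω := hω
        have d := hml ω k hk1 hk2
        have b := abs_le.mp (hle ω 0 (by omega))
        have c := abs_le.mp (hle ω k hk2)
        constructor <;> linarith [b.1, b.2, c.1, c.2])
  rw [abs_le]
  constructor <;> linarith
end
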